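/- arXiv:2402.06943 — 4 statements merged into one kernel-verified Lean document; each statement's English description precedes it below -/
import Mathlib

section
/- Let X be a complex Banach space and A : D(A) ⊆ X → X a closed linear operator such that every ik (k a nonzero integer) is a regular point of A, with ‖(A − ikI)^{-1}‖ ≤ C/|k| for all nonzero integers k and some constant C > 0. If f ∈ D(A²), then the sequence of partial sums v_n(t) = f + (t − π)Af + 2 ∑_{k=1}^{n} ( Σ_k(Af) cos(kt) + Υ_k(Af) sin(kt) ) converges uniformly in t on [0, 2π] as n → ∞. -/
open MeasureTheory Real Filter Topology

noncomputable section

/-- `A` maps the subspace `D` linearly into `X`. -/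
def IsLinearOn {X : Type*} [NormedAddCommGroup X] [NormedSpace ℂ X]
    (A : X → X) (D : Submodule ℂ X) : Prop :=
  (∀ x ∈ D, ∀ y ∈ D, A (x + y) = A x + A y) ∧
  ∀ (c : ℂ), ∀ x ∈ D, A (c • x) = c • A x

/-- `A` is a closed operator with domain `D`. -/
def IsClosedOp {X : Type*} [NormedAddCommGroup X] [NormedSpace ℂ X]
    (A : X → X) (D : Submodule ℂ X) : Prop :=
  ∀ (u : ℕ → X) (x y : X), (∀ n, u n ∈ D) →
    Filter.Tendsto u Filter.atTop (nhds x) →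
    Filter.Tendsto (fun n => A (u n)) Filter.atTop (nhds y) →
    x ∈ D ∧ A x = y

/-- `R` is the (bounded, everywhere defined) inverse of `A - i k I`, i.e. `i k` is a
regular point of `A` with resolvent `R`. -/
def IsResolventAt {X : Type*} [NormedAddCommGroup X] [NormedSpace ℂ X]
    (A : X → X) (D : Submodule ℂ X) (k : ℤ) (R : X →L[ℂ] X) : Prop :=
  (∀ g : X, R g ∈ D ∧ A (R g) - (Complex.I * k) • R g = g) ∧
  ∀ x ∈ D, R (A x - (Complex.I * k) • x) = x

/-- `v` is a solution of `dv/dt = A v` on `(0, 2π)` with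
`(1/(2π)) ∫₀^{2π} v(t) dt = f`. -/
def IsSolution {X : Type*} [NormedAddCommGroup X] [NormedSpace ℂ X] [CompleteSpace X]
    (A : X → X) (D : Submodule ℂ X) (f : X) (v : ℝ → X) : Prop :=
  ContinuousOn v (Set.Icc 0 (2*π)) ∧
  (∀ t ∈ Set.Ioo 0 (2*π), v t ∈ D) ∧
  (∀ t ∈ Set.Ioo 0 (2*π), HasDerivAt v (A (v t)) t) ∧
  ContinuousOn (fun t => A (v t)) (Set.Ioo 0 (2*π)) ∧
  (1/(2*π) : ℝ) • (∫ t in (0:ℝ)..(2*π), v t) = f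

/-- `Σ_k = A (A + i k I)⁻¹ (A - i k I)⁻¹` applied to `g`. -/
def SigmaOp {X : Type*} [NormedAddCommGroup X] [NormedSpace ℂ X]
    (A : X → X) (R : ℤ → X →L[ℂ] X) (k : ℕ) (g : X) : X :=
  A (R (-(k:ℤ)) (R (k:ℤ) g))

/-- `Υ_k = k⁻¹ A² (A + i k I)⁻¹ (A - i k I)⁻¹` applied to `g`. -/
def UpsilonOp {X : Type*} [NormedAddCommGroup X] [NormedSpace ℂ X]
    (A : X → X) (R : ℤ → X →L[ℂ] X) (k : ℕ) (g : X) : X :=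
  ((k:ℂ))⁻¹ • A (A (R (-(k:ℤ)) (R (k:ℤ) g)))

namespace IsResolventAt

variable {X : Type*} [NormedAddCommGroup X] [NormedSpace ℂ X]
  {A : X → X} {D : Submodule ℂ X} {k : ℤ} {R : X →L[ℂ] X}

lemma mem_domain (h : IsResolventAt A D k R) (g : X) : R g ∈ D := (h.1 g).1

lemma apply_eq (h : IsResolventAt A D k R) (g : X) :
    A (R g) = g + (Complex.I * k) • R g :=
  sub_eq_iff_eq_add.mp (h.1 g).2

lemma apply_comm (h : IsResolventAt A D k R) {x : X} (hx : x ∈ D) : A (R x) = R (A x) := by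
  have h₂ := h.2 x hx
  rw [map_sub, map_smul, sub_eq_iff_eq_add] at h₂
  rw [h.apply_eq, h₂]

lemma norm_apply_le (h : IsResolventAt A D k R) {C : ℝ} (hk : k ≠ 0)
    (hR : ‖R‖ ≤ C / |(k : ℝ)|) (g : X) : ‖A (R g)‖ ≤ (1 + C) * ‖g‖ := by
  have hk' : 0 < |(k : ℝ)| := abs_pos.mpr (Int.cast_ne_zero.mpr hk)
  have hRg : |(k : ℝ)| * ‖R g‖ ≤ C * ‖g‖ :=
    calc |(k : ℝ)| * ‖R g‖ ≤ |(k : ℝ)| * (C / |(k : ℝ)| * ‖g‖) := by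
          gcongr
          exact R.le_of_opNorm_le hR g
      _ = C * ‖g‖ := by field_simp
  calc ‖A (R g)‖ ≤ ‖g‖ + ‖(Complex.I * k) • R g‖ := by
        rw [h.apply_eq]
        exact norm_add_le _ _
    _ = ‖g‖ + |(k : ℝ)| * ‖R g‖ := by simp [norm_smul]
    _ ≤ (1 + C) * ‖g‖ := by linarith

end IsResolventAt

section Bounds

variable {X : Type*} [NormedAddCommGroup X] [NormedSpace ℂ X]
  {A : X → X} {D : Submodule ℂ X} {R : ℤ → X →L[ℂ] X} {C : ℝ} {k : ℕ} {g : X}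

lemma sigmaOp_eq (hres : ∀ k : ℤ, k ≠ 0 → IsResolventAt A D k (R k)) (hk : k ≠ 0) (hg : g ∈ D) :
    SigmaOp A R k g = R (-(k : ℤ)) (R (k : ℤ) (A g)) := by
  have hp := hres (k : ℤ) (by simpa using hk)
  have hn := hres (-(k : ℤ)) (by simpa using hk)
  rw [SigmaOp, hn.apply_comm (hp.mem_domain g), hp.apply_comm hg]

lemma norm_resolvent_natCast_le (hbound : ∀ k : ℤ, k ≠ 0 → ‖R k‖ ≤ C / |(k : ℝ)|) (hk : k ≠ 0)
    (x : X) : ‖R (k : ℤ) x‖ ≤ C / k * ‖x‖ := by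
  have := hbound (k : ℤ) (by simpa using hk)
  exact (R (k : ℤ)).le_of_opNorm_le (by simpa using this) x

lemma norm_sigmaOp_le (hC : 0 ≤ C) (hres : ∀ k : ℤ, k ≠ 0 → IsResolventAt A D k (R k))
    (hbound : ∀ k : ℤ, k ≠ 0 → ‖R k‖ ≤ C / |(k : ℝ)|) (hk : k ≠ 0) (hg : g ∈ D) :
    ‖SigmaOp A R k g‖ ≤ C ^ 2 * ‖A g‖ / (k : ℝ) ^ 2 := by
  have hn : ‖R (-(k : ℤ))‖ ≤ C / k := by
    simpa using hbound (-(k : ℤ)) (by simpa using hk)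
  calc ‖SigmaOp A R k g‖ ≤ C / k * ‖R (k : ℤ) (A g)‖ := by
        rw [sigmaOp_eq hres hk hg]
        exact (R (-(k : ℤ))).le_of_opNorm_le hn _
    _ ≤ C / k * (C / k * ‖A g‖) := by
        gcongr
        exact norm_resolvent_natCast_le hbound hk _
    _ = C ^ 2 * ‖A g‖ / (k : ℝ) ^ 2 := by ring

lemma norm_upsilonOp_le (hC : 0 ≤ C) (hres : ∀ k : ℤ, k ≠ 0 → IsResolventAt A D k (R k))
    (hbound : ∀ k : ℤ, k ≠ 0 → ‖R k‖ ≤ C / |(k : ℝ)|) (hk : k ≠ 0) (hg : g ∈ D) :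
    ‖UpsilonOp A R k g‖ ≤ (1 + C) * C * ‖A g‖ / (k : ℝ) ^ 2 := by
  have hk' : -(k : ℤ) ≠ 0 := by simpa using hk
  calc ‖UpsilonOp A R k g‖ = (k : ℝ)⁻¹ * ‖A (SigmaOp A R k g)‖ := by
        simp [UpsilonOp, SigmaOp, norm_smul]
    _ ≤ (k : ℝ)⁻¹ * ((1 + C) * ‖R (k : ℤ) (A g)‖) := by
        rw [sigmaOp_eq hres hk hg]
        gcongr
        exact (hres _ hk').norm_apply_le hk' (hbound _ hk') _
    _ ≤ (k : ℝ)⁻¹ * ((1 + C) * (C / k * ‖A g‖)) := by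
        gcongr
        exact norm_resolvent_natCast_le hbound hk _
    _ = (1 + C) * C * ‖A g‖ / (k : ℝ) ^ 2 := by ring

end Bounds

lemma norm_cos_smul_add_sin_smul_le {X : Type*} [NormedAddCommGroup X] [NormedSpace ℝ X]
    (s : ℝ) (x y : X) : ‖Real.cos s • x + Real.sin s • y‖ ≤ ‖x‖ + ‖y‖ := by
  refine (norm_add_le _ _).trans (add_le_add ?_ ?_) <;>
    rw [norm_smul, Real.norm_eq_abs] <;>
    refine mul_le_of_le_one_left (norm_nonneg _) ?_
  exacts [Real.abs_cos_le_one s, Real.abs_sin_le_one s]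

theorem partial_sums_converge_uniformly
    {X : Type*} [NormedAddCommGroup X] [NormedSpace ℂ X] [CompleteSpace X]
    (A : X → X) (D : Submodule ℂ X) (R : ℤ → X →L[ℂ] X) (C : ℝ) (hC : 0 < C)
    (hlin : IsLinearOn A D) (hclosed : IsClosedOp A D)
    (hres : ∀ k : ℤ, k ≠ 0 → IsResolventAt A D k (R k))
    (hbound : ∀ k : ℤ, k ≠ 0 → ‖R k‖ ≤ C / |(k:ℝ)|)
    (f : X) (hf : f ∈ D) (hAf : A f ∈ D) :
    ∃ v : ℝ → X,
      TendstoUniformlyOn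
        (fun (n : ℕ) (t : ℝ) =>
          f + (t - π) • A f + (2:ℝ) •
            ∑ k ∈ Finset.range n,
              (Real.cos (((k:ℝ)+1)*t) • SigmaOp A R (k+1) (A f)
             + Real.sin (((k:ℝ)+1)*t) • UpsilonOp A R (k+1) (A f)))
        v Filter.atTop (Set.Icc 0 (2*π)) := by
  set M : ℝ := C ^ 2 * ‖A (A f)‖ + (1 + C) * C * ‖A (A f)‖
  have hsum : Summable fun k : ℕ => M / ((k : ℝ) + 1) ^ 2 := by
    have h := (summable_nat_add_iff 1).mpr (Real.summable_one_div_nat_pow.mpr one_lt_two)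
    simpa [div_eq_mul_inv] using h.mul_left M
  have hunif := tendstoUniformlyOn_tsum_nat (s := Set.Icc 0 (2 * π)) hsum
    (f := fun (k : ℕ) (t : ℝ) => Real.cos (((k : ℝ) + 1) * t) • SigmaOp A R (k + 1) (A f)
      + Real.sin (((k : ℝ) + 1) * t) • UpsilonOp A R (k + 1) (A f)) fun k t _ => by
    have hSigma := norm_sigmaOp_le hC.le hres hbound k.succ_ne_zero hAf
    have hUpsilon := norm_upsilonOp_le hC.le hres hbound k.succ_ne_zero hAf
    push_cast at hSigma hUpsilon
    calc _ ≤ ‖SigmaOp A R (k + 1) (A f)‖ + ‖UpsilonOp A R (k + 1) (A f)‖ :=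
          norm_cos_smul_add_sin_smul_le _ _ _
      _ ≤ M / ((k : ℝ) + 1) ^ 2 := (add_le_add hSigma hUpsilon).trans_eq (add_div _ _ _).symm
  refine ⟨fun t => f + (t - π) • A f + (2 : ℝ) • ∑' k : ℕ,
    (Real.cos (((k : ℝ) + 1) * t) • SigmaOp A R (k + 1) (A f)
      + Real.sin (((k : ℝ) + 1) * t) • UpsilonOp A R (k + 1) (A f)), ?_⟩
  have hsmul := (uniformContinuous_const_smul (2 : ℝ)).comp_tendstoUniformlyOn hunif
  rw [Metric.tendstoUniformlyOn_iff] at hsmul ⊢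
  simpa only [dist_add_left, Function.comp_apply] using hsmul
end
end

section
/- Let X be a complex Banach space and A : D(A) ⊆ X → X a closed linear operator such that for every nonzero integer k the operator A − ikI : D(A) → X is injective. If v : [0,2π] → X is continuous, v(t) ∈ D(A) for 0 < t < 2π, v ∈ C¹((0,2π);X) with Av ∈ C((0,2π);X), v'(t) = A v(t) for 0 < t < 2π, and (1/(2π))∫₀^{2π} v(t) dt = 0, then v(t) = 0 for all t ∈ [0, 2π]. -/
open MeasureTheory Real Filter Topology

noncomputable section

theorem Submodule.setIntegral_Ioc_mem {E : Type*} [NormedAddCommGroup E] [NormedSpace ℂ E]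
    [CompleteSpace E] (G : Submodule ℂ E) (hG : IsClosed (G : Set E)) {f : ℝ → E} {a b : ℝ}
    (hab : a < b) (hf : ∀ t ∈ Set.Ioc a b, f t ∈ G) (hfi : IntegrableOn f (Set.Ioc a b)) :
    ∫ t in Set.Ioc a b, f t ∈ G := by
  have h0 : volume (Set.Ioc a b) ≠ 0 := by simp [hab]
  have ht : volume (Set.Ioc a b) ≠ ⊤ := by simp
  have hconv : Convex ℝ (G : Set E) := (G.restrictScalars ℝ).convex
  have havg := hconv.set_average_mem hG h0 ht
    (ae_restrict_of_forall_mem measurableSet_Ioc hf) hfi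
  rw [← measure_smul_setAverage f ht]
  exact (G.restrictScalars ℝ).smul_mem _ havg

/-- The graph of an operator that is linear on its domain. -/
def IsLinearOn.graph {X : Type*} [NormedAddCommGroup X] [NormedSpace ℂ X]
    {A : X → X} {D : Submodule ℂ X} (hlin : IsLinearOn A D) : Submodule ℂ (X × X) where
  carrier := {p | p.1 ∈ D ∧ A p.1 = p.2}
  add_mem' := by
    rintro ⟨x, x'⟩ ⟨y, y'⟩ ⟨hx, hx'⟩ ⟨hy, hy'⟩
    refine ⟨D.add_mem hx hy, ?_⟩
    simp only at hx hy hx' hy'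
    simp only [Prod.mk_add_mk, hlin.1 x hx y hy, hx', hy']
  zero_mem' := ⟨D.zero_mem, by simpa using hlin.2 0 0 D.zero_mem⟩
  smul_mem' := by
    rintro c ⟨x, x'⟩ ⟨hx, hx'⟩
    refine ⟨D.smul_mem c hx, ?_⟩
    simp only at hx hx'
    simp only [Prod.smul_mk, hlin.2 c x hx, hx']

theorem IsLinearOn.isClosed_graph {X : Type*} [NormedAddCommGroup X] [NormedSpace ℂ X]
    {A : X → X} {D : Submodule ℂ X} (hlin : IsLinearOn A D) (hclosed : IsClosedOp A D) :
    IsClosed (hlin.graph : Set (X × X)) := by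
  refine IsSeqClosed.isClosed fun p q hp hpq => ?_
  refine hclosed (fun n => (p n).1) q.1 q.2 (fun n => (hp n).1) (hpq.fst_nhds) ?_
  exact hpq.snd_nhds.congr fun n => (hp n).2.symm

theorem IsClosedOp.intervalIntegral_mem {X : Type*} [NormedAddCommGroup X] [NormedSpace ℂ X]
    [CompleteSpace X] {A : X → X} {D : Submodule ℂ X} (hclosed : IsClosedOp A D)
    (hlin : IsLinearOn A D) {f g : ℝ → X} {a b : ℝ} (hab : a < b)
    (hf : ContinuousOn f (Set.Icc a b)) (hg : ContinuousOn g (Set.Icc a b))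
    (hmem : ∀ t ∈ Set.Icc a b, f t ∈ D) (hfg : ∀ t ∈ Set.Icc a b, A (f t) = g t) :
    ∫ t in a..b, f t ∈ D ∧ A (∫ t in a..b, f t) = ∫ t in a..b, g t := by
  have hfi : IntegrableOn f (Set.Ioc a b) := hf.integrableOn_Icc.mono_set Set.Ioc_subset_Icc_self
  have hgi : IntegrableOn g (Set.Ioc a b) := hg.integrableOn_Icc.mono_set Set.Ioc_subset_Icc_self
  have h := hlin.graph.setIntegral_Ioc_mem (hlin.isClosed_graph hclosed) hab
    (f := fun t => (f t, g t))
    (fun t ht => ⟨hmem t (Set.Ioc_subset_Icc_self ht), hfg t (Set.Ioc_subset_Icc_self ht)⟩)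
    (hfi.prodMk hgi)
  rw [integral_pair hfi hgi] at h
  simp only [intervalIntegral.integral_of_le hab.le]
  exact h

/-- For a solution of `v' = A v`, the integral of `exp (-c t) • v t` over a compact subinterval
lies in the domain, and `A - c` maps it to the boundary term. -/
theorem IsClosedOp.apply_integral_exp_smul {X : Type*} [NormedAddCommGroup X] [NormedSpace ℂ X]
    [CompleteSpace X] {A : X → X} {D : Submodule ℂ X} (hclosed : IsClosedOp A D)
    (hlin : IsLinearOn A D) {v : ℝ → X} {a b : ℝ} (hab : a < b) (c : ℂ)
    (hmem : ∀ t ∈ Set.Icc a b, v t ∈ D)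
    (hderiv : ∀ t ∈ Set.Icc a b, HasDerivAt v (A (v t)) t)
    (hAv : ContinuousOn (fun t => A (v t)) (Set.Icc a b)) :
    ∫ t in a..b, Complex.exp (-c * t) • v t ∈ D ∧
    A (∫ t in a..b, Complex.exp (-c * t) • v t) =
      Complex.exp (-c * b) • v b - Complex.exp (-c * a) • v a +
        c • ∫ t in a..b, Complex.exp (-c * t) • v t := by
  have hv : ContinuousOn v (Set.Icc a b) := fun t ht =>
    (hderiv t ht).continuousAt.continuousWithinAt
  have hexp : ContinuousOn (fun t : ℝ => Complex.exp (-c * t)) (Set.Icc a b) :=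
    Continuous.continuousOn (by fun_prop)
  have hw := hexp.smul hv
  have hwA := hexp.smul hAv
  obtain ⟨h1, h2⟩ := hclosed.intervalIntegral_mem hlin hab hw hwA
    (fun t ht => D.smul_mem _ (hmem t ht)) (fun t ht => hlin.2 _ _ (hmem t ht))
  refine ⟨h1, h2.trans ?_⟩
  have hd : ∀ t ∈ Set.uIcc a b, HasDerivAt (fun t : ℝ => Complex.exp (-c * t) • v t)
      (Complex.exp (-c * t) • A (v t) - c • Complex.exp (-c * t) • v t) t := by
    intro t ht
    rw [Set.uIcc_of_le hab.le] at ht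
    have he : HasDerivAt (fun t : ℝ => Complex.exp (-c * t)) (Complex.exp (-c * t) * -c) t := by
      simpa using ((Complex.ofRealCLM.hasDerivAt (x := t)).const_mul (-c)).cexp
    exact (he.smul (hderiv t ht)).congr_deriv (by module)
  have hwi := hw.intervalIntegrable_of_Icc (μ := volume) hab.le
  have hwAi := hwA.intervalIntegrable_of_Icc (μ := volume) hab.le
  have hftc := intervalIntegral.integral_eq_sub_of_hasDerivAt hd (hwAi.sub (hwi.smul c))
  have hsub := intervalIntegral.integral_sub hwAi (hwi.smul c)
  have hsmul := intervalIntegral.integral_smul (μ := volume) (a := a) (b := b) c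
    (fun t : ℝ => Complex.exp (-c * t) • v t)
  rw [← hftc, ← hsmul]
  exact eq_add_of_sub_eq hsub.symm

theorem tendsto_intervalIntegral_of_continuousOn {X : Type*} [NormedAddCommGroup X]
    [NormedSpace ℝ X] {w : ℝ → X} {a b : ℝ} (hab : a ≤ b)
    (hw : ContinuousOn w (Set.Icc a b)) {p q : ℕ → ℝ} (hp : ∀ n, p n ∈ Set.Icc a b)
    (hq : ∀ n, q n ∈ Set.Icc a b) (hpa : Tendsto p atTop (𝓝 a)) (hqb : Tendsto q atTop (𝓝 b)) :
    Tendsto (fun n => ∫ t in p n..q n, w t) atTop (𝓝 (∫ t in a..b, w t)) := by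
  have hi : ∀ t ∈ Set.Icc a b, IntervalIntegrable w volume a t := fun t ht =>
    (hw.mono (Set.Icc_subset_Icc_right ht.2)).intervalIntegrable_of_Icc ht.1
  have hF : ContinuousOn (fun x => ∫ t in a..x, w t) (Set.Icc a b) := by
    have := intervalIntegral.continuousOn_primitive_interval (μ := volume) (f := w) (a := a)
      (b := b) (by rw [Set.uIcc_of_le hab]; exact hw.integrableOn_Icc)
    rwa [Set.uIcc_of_le hab] at this
  have hlim : ∀ {r : ℕ → ℝ} {x : ℝ}, x ∈ Set.Icc a b → (∀ n, r n ∈ Set.Icc a b) →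
      Tendsto r atTop (𝓝 x) →
      Tendsto (fun n => ∫ t in a..r n, w t) atTop (𝓝 (∫ t in a..x, w t)) := fun hx hr hrx =>
    (hF _ hx).tendsto.comp (tendsto_nhdsWithin_iff.2 ⟨hrx, .of_forall hr⟩)
  have h := (hlim (Set.right_mem_Icc.2 hab) hq hqb).sub (hlim (Set.left_mem_Icc.2 hab) hp hpa)
  rw [intervalIntegral.integral_same, sub_zero] at h
  exact h.congr fun n => intervalIntegral.integral_interval_sub_left (hi _ (hq n)) (hi _ (hp n))

/-- The version of `IsClosedOp.apply_integral_exp_smul` for a solution on an open interval which is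
continuous up to the end points. -/
theorem IsClosedOp.apply_integral_exp_smul_of_Ioo {X : Type*} [NormedAddCommGroup X]
    [NormedSpace ℂ X] [CompleteSpace X] {A : X → X} {D : Submodule ℂ X}
    (hclosed : IsClosedOp A D) (hlin : IsLinearOn A D) {v : ℝ → X} {a b : ℝ} (hab : a < b) (c : ℂ)
    (hv : ContinuousOn v (Set.Icc a b))
    (hmem : ∀ t ∈ Set.Ioo a b, v t ∈ D)
    (hderiv : ∀ t ∈ Set.Ioo a b, HasDerivAt v (A (v t)) t)
    (hAv : ContinuousOn (fun t => A (v t)) (Set.Ioo a b)) :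
    ∫ t in a..b, Complex.exp (-c * t) • v t ∈ D ∧
    A (∫ t in a..b, Complex.exp (-c * t) • v t) =
      Complex.exp (-c * b) • v b - Complex.exp (-c * a) • v a +
        c • ∫ t in a..b, Complex.exp (-c * t) • v t := by
  have hw : ContinuousOn (fun t : ℝ => Complex.exp (-c * t) • v t) (Set.Icc a b) :=
    (Continuous.continuousOn (by fun_prop)).smul hv
  obtain ⟨m, hm⟩ := exists_between hab
  obtain ⟨p, -, hp, hpa⟩ := exists_seq_strictAnti_tendsto' hm.1
  obtain ⟨q, -, hq, hqb⟩ := exists_seq_strictMono_tendsto' hm.2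
  have hp' : ∀ n, p n ∈ Set.Icc a b := fun n => ⟨(hp n).1.le, ((hp n).2.trans hm.2).le⟩
  have hq' : ∀ n, q n ∈ Set.Icc a b := fun n => ⟨(hm.1.trans (hq n).1).le, (hq n).2.le⟩
  have hsub : ∀ n, Set.Icc (p n) (q n) ⊆ Set.Ioo a b := fun n t ht =>
    ⟨(hp n).1.trans_le ht.1, ht.2.trans_lt (hq n).2⟩
  have key := fun n => hclosed.apply_integral_exp_smul hlin ((hp n).2.trans (hq n).1) c
    (fun t ht => hmem t (hsub n ht)) (fun t ht => hderiv t (hsub n ht)) (hAv.mono (hsub n))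
  have hlim := tendsto_intervalIntegral_of_continuousOn hab.le hw hp' hq' hpa hqb
  refine hclosed _ _ _ (fun n => (key n).1) hlim (Tendsto.congr (fun n => (key n).2.symm) ?_)
  refine Tendsto.add (Tendsto.sub ?_ ?_) (hlim.const_smul c)
  · exact (hw b (Set.right_mem_Icc.2 hab.le)).tendsto.comp
      (tendsto_nhdsWithin_iff.2 ⟨hqb, .of_forall hq'⟩)
  · exact (hw a (Set.left_mem_Icc.2 hab.le)).tendsto.comp
      (tendsto_nhdsWithin_iff.2 ⟨hpa, .of_forall hp'⟩)

/-- A continuous `2π`-periodic function all of whose Fourier coefficients vanish is zero. -/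
theorem eq_zero_of_forall_integral_exp_smul_eq_zero {X : Type*} [NormedAddCommGroup X]
    [NormedSpace ℂ X] [CompleteSpace X] {v : ℝ → X} (hv : ContinuousOn v (Set.Icc 0 (2 * π)))
    (hper : v 0 = v (2 * π))
    (hcoeff : ∀ k : ℤ, ∫ t in (0:ℝ)..(2 * π), Complex.exp (-(Complex.I * k) * t) • v t = 0) :
    ∀ t ∈ Set.Icc (0:ℝ) (2 * π), v t = 0 := by
  have hpos := Real.two_pi_pos
  have : Fact (0 < 2 * π) := ⟨hpos⟩
  have hIco : ∀ t ∈ Set.Ico (0:ℝ) (2 * π), v t = 0 := by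
    intro t ht
    refine SeparatingDual.eq_zero_of_forall_dual_eq_zero (R := ℂ) fun φ => ?_
    let f : C(AddCircle (2 * π), ℂ) := ⟨AddCircle.liftIco (2 * π) 0 (fun s => φ (v s)),
      AddCircle.liftIco_continuous (by simp [hper])
        (by rw [zero_add]; exact φ.continuous.comp_continuousOn hv)⟩
    have hf : fourierCoeff f = 0 := by
      ext n
      have hc := congrArg φ (hcoeff n)
      have hwi : IntervalIntegrable (fun t : ℝ => Complex.exp (-(Complex.I * n) * t) • v t)
          volume 0 (2 * π) :=
        ContinuousOn.intervalIntegrable_of_Icc hpos.le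
          ((Continuous.continuousOn (by fun_prop)).smul hv)
      rw [← φ.intervalIntegral_comp_comm hwi, map_zero] at hc
      change fourierCoeff (AddCircle.liftIco (2 * π) 0 (fun s => φ (v s))) n = 0
      rw [fourierCoeff_liftIco_eq, fourierCoeffOn_eq_integral]
      simp only [zero_add, sub_zero]
      convert! smul_zero _ using 2
      rw [← hc]
      refine intervalIntegral.integral_congr fun s _ => ?_
      simp only [fourier_coe_apply, map_smul]
      congr 2
      have : (π : ℂ) ≠ 0 := by exact_mod_cast Real.pi_ne_zero
      push_cast
      field_simp
      ring
    have hs := has_pointwise_sum_fourier_series_of_summable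
      (f := f) (by rw [hf]; exact summable_zero) t
    simp only [hf, Pi.zero_apply, zero_smul] at hs
    have hft : f t = φ (v t) :=
      AddCircle.liftIco_zero_coe_apply (f := fun s => φ (v s)) ht
    rw [← hft]
    exact hs.unique hasSum_zero
  intro t ht
  rcases ht.2.eq_or_lt with rfl | h
  · rw [← hper]; exact hIco 0 ⟨le_rfl, hpos⟩
  · exact hIco t ⟨ht.1, h⟩

theorem uniqueness_of_solution
    {X : Type*} [NormedAddCommGroup X] [NormedSpace ℂ X] [CompleteSpace X]
    (A : X → X) (D : Submodule ℂ X)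
    (hlin : IsLinearOn A D) (hclosed : IsClosedOp A D)
    (hinj : ∀ k : ℤ, k ≠ 0 → ∀ x ∈ D, ∀ y ∈ D,
      A x - (Complex.I * k) • x = A y - (Complex.I * k) • y → x = y)
    (v : ℝ → X)
    (hv_cont : ContinuousOn v (Set.Icc 0 (2*π)))
    (hv_mem : ∀ t ∈ Set.Ioo 0 (2*π), v t ∈ D)
    (hv_deriv : ∀ t ∈ Set.Ioo 0 (2*π), HasDerivAt v (A (v t)) t)
    (hAv_cont : ContinuousOn (fun t => A (v t)) (Set.Ioo 0 (2*π)))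
    (hint : (1/(2*π) : ℝ) • (∫ t in (0:ℝ)..(2*π), v t) = 0) :
    ∀ t ∈ Set.Icc (0:ℝ) (2*π), v t = 0 := by
  have key := fun k : ℤ => hclosed.apply_integral_exp_smul_of_Ioo hlin Real.two_pi_pos
    (Complex.I * k) hv_cont hv_mem hv_deriv hAv_cont
  have hA0 : A 0 = 0 := by simpa using hlin.2 0 0 D.zero_mem
  have hint0 : ∫ t in (0:ℝ)..(2*π), v t = 0 :=
    (smul_eq_zero.1 hint).resolve_left (by positivity)
  have hper : v 0 = v (2*π) := by
    have h := (key 0).2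
    simp only [Int.cast_zero, mul_zero, neg_zero, zero_mul, Complex.exp_zero, one_smul, hint0,
      hA0, zero_smul, add_zero] at h
    exact (sub_eq_zero.1 h.symm).symm
  refine eq_zero_of_forall_integral_exp_smul_eq_zero hv_cont hper fun k => ?_
  rcases eq_or_ne k 0 with rfl | hk
  · simpa using hint0
  · refine hinj k hk _ (key k).1 0 D.zero_mem ?_
    have he : Complex.exp (-(Complex.I * k) * (2 * π : ℝ)) = 1 :=
      Complex.exp_eq_one_iff.2 ⟨-k, by push_cast; ring⟩
    rw [(key k).2, he, ← hper, hA0]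
    simp
end
end

section
/- Let X be a complex Banach space and A : D(A) ⊆ X → X a closed linear operator such that ik and −ik are regular points of A for all integers k ≥ 1, with ‖(A − ikI)^{-1}‖ ≤ C/|k| for all nonzero integers k and some constant C > 0. Then there exists a constant K > 0 such that ‖Σ_k − Σ_{k+1}‖ ≤ K/k² and ‖Υ_k − Υ_{k+1}‖ ≤ K/k² for all k = 1, 2, …, where the norms are operator norms. -/
open MeasureTheory Real Filter Topology

noncomputable section

/-- `V_k = (A² + k² I)⁻¹ = (A + i k I)⁻¹ (A - i k I)⁻¹` applied to `g`. -/
def VOp {X : Type*} [NormedAddCommGroup X] [NormedSpace ℂ X]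
    (R : ℤ → X →L[ℂ] X) (k : ℕ) (g : X) : X :=
  R (-(k:ℤ)) (R (k:ℤ) g)

/-- Resolvent identity `R m - R n = i (m - n) R m R n`. -/
theorem IsResolventAt.sub_apply {X : Type*} [NormedAddCommGroup X] [NormedSpace ℂ X]
    {A : X → X} {D : Submodule ℂ X} {m n : ℤ} {P Q : X →L[ℂ] X}
    (hP : IsResolventAt A D m P) (hQ : IsResolventAt A D n Q) (g : X) :
    P g - Q g = (Complex.I * (m - n)) • P (Q g) := by
  obtain ⟨hmem, heq⟩ := hQ.1 g
  have h := hP.2 _ hmem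
  have hg : g = (A (Q g) - (Complex.I * m) • Q g) + (Complex.I * (m - n)) • Q g := by
    nth_rewrite 1 [← heq]
    module
  nth_rewrite 1 [hg]
  rw [map_add, h, map_smul]
  abel

theorem IsResolventAt.apply_eq_s12 {X : Type*} [NormedAddCommGroup X] [NormedSpace ℂ X]
    {A : X → X} {D : Submodule ℂ X} {m : ℤ} {P : X →L[ℂ] X}
    (hP : IsResolventAt A D m P) (g : X) : A (P g) = g + (Complex.I * m) • P g :=
  sub_eq_iff_eq_add.mp (hP.1 g).2

/-- Consecutive resolvents along the imaginary axis differ by `O(k⁻²)`. -/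
theorem norm_resolvent_sub_le {X : Type*} [NormedAddCommGroup X] [NormedSpace ℂ X]
    {A : X → X} {D : Submodule ℂ X} {R : ℤ → X →L[ℂ] X} {C : ℝ}
    (hres : ∀ k : ℤ, k ≠ 0 → IsResolventAt A D k (R k))
    (hbound : ∀ k : ℤ, k ≠ 0 → ‖R k‖ ≤ C / |(k:ℝ)|)
    {k : ℕ} (hk : 1 ≤ k) {m n : ℤ} (hm : |m| = k) (hn : |n| = k + 1) (hmn : |m - n| = 1) :
    ‖R m - R n‖ ≤ C ^ 2 / (k:ℝ) ^ 2 := by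
  have hk0 : (0:ℝ) < k := by exact_mod_cast hk
  have hm0 : m ≠ 0 := by rintro rfl; simp at hm; omega
  have hn0 : n ≠ 0 := by rintro rfl; simp at hn; omega
  have e : R m - R n = (Complex.I * (m - n)) • (R m).comp (R n) := by
    ext g
    simpa using (hres m hm0).sub_apply (hres n hn0) g
  have hmR : |(m:ℝ)| = k := by exact_mod_cast congrArg (Int.cast (R := ℝ)) hm
  have hnR : |(n:ℝ)| = k + 1 := by exact_mod_cast congrArg (Int.cast (R := ℝ)) hn
  have hc : ‖Complex.I * ((m:ℂ) - n)‖ = 1 := by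
    rw [norm_mul, Complex.norm_I, one_mul, ← Int.cast_sub, Complex.norm_intCast]
    exact_mod_cast congrArg (Int.cast (R := ℝ)) hmn
  have h1 := hbound m hm0
  have h2 := hbound n hn0
  rw [hmR] at h1
  rw [hnR] at h2
  have hC : 0 ≤ C := by
    by_contra! h
    exact absurd ((norm_nonneg _).trans h1) (not_le.mpr (div_neg_of_neg_of_pos h hk0))
  have h3 : ‖R n‖ ≤ C / k := h2.trans (by gcongr; linarith)
  rw [e, norm_smul, hc, one_mul]
  calc ‖(R m).comp (R n)‖ ≤ ‖R m‖ * ‖R n‖ := ContinuousLinearMap.opNorm_comp_le _ _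
    _ ≤ C / k * (C / k) := by gcongr
    _ = C ^ 2 / (k:ℝ) ^ 2 := by ring

theorem sigma_upsilon_difference_bounds
    {X : Type*} [NormedAddCommGroup X] [NormedSpace ℂ X] [CompleteSpace X]
    (A : X → X) (D : Submodule ℂ X) (R : ℤ → X →L[ℂ] X) (C : ℝ) (hC : 0 < C)
    (hlin : IsLinearOn A D) (hclosed : IsClosedOp A D)
    (hres : ∀ k : ℤ, k ≠ 0 → IsResolventAt A D k (R k))
    (hbound : ∀ k : ℤ, k ≠ 0 → ‖R k‖ ≤ C / |(k:ℝ)|)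
    (S U : ℕ → X →L[ℂ] X)
    (hS : ∀ k : ℕ, 1 ≤ k → ∀ g : X, S k g = A (VOp R k g))
    (hU : ∀ k : ℕ, 1 ≤ k → ∀ g : X, U k g = ((k:ℂ))⁻¹ • A (A (VOp R k g))) :
    ∃ K : ℝ, 0 < K ∧ ∀ k : ℕ, 1 ≤ k →
      ‖S k - S (k+1)‖ ≤ K / (k:ℝ)^2 ∧ ‖U k - U (k+1)‖ ≤ K / (k:ℝ)^2 := by
  have hopp : ∀ k : ℕ, 1 ≤ k → ∀ g,
      R k g - R (-(k:ℤ)) g = (2 * Complex.I * k) • VOp R k g := by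
    intro k hk g
    have h := (hres (-(k:ℤ)) (by omega)).sub_apply (hres k (by omega)) g
    rw [← neg_sub, h, VOp]
    push_cast
    module
  have hAV : ∀ k : ℕ, 1 ≤ k → ∀ g,
      A (VOp R k g) = R k g + -(Complex.I * k) • VOp R k g := by
    intro k hk g
    rw [VOp, (hres (-(k:ℤ)) (by omega)).apply_eq_s12]
    push_cast
    module
  have hS' : ∀ k : ℕ, 1 ≤ k → S k = (2⁻¹ : ℂ) • (R k + R (-(k:ℤ))) := by
    intro k hk
    ext g
    have h : R (-(k:ℤ)) g = R k g - (2 * Complex.I * k) • VOp R k g := by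
      rw [sub_eq_iff_eq_add.mp (hopp k hk g)]
      module
    rw [hS k hk, hAV k hk]
    simp only [smul_apply, add_apply, h]
    module
  have hU' : ∀ k : ℕ, 1 ≤ k → U k =
      ((k:ℂ))⁻¹ • ContinuousLinearMap.id ℂ X + (Complex.I / 2) • (R k - R (-(k:ℤ))) := by
    intro k hk
    ext g
    have hk0 : (k:ℂ) ≠ 0 := by exact_mod_cast (by omega : k ≠ 0)
    have hV : VOp R k g ∈ D := ((hres (-(k:ℤ)) (by omega)).1 _).1
    have hP := (hres k (by omega)).1 g
    have hAP := (hres k (by omega)).apply_eq_s12 g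
    rw [Int.cast_natCast] at hAP
    have hAA : A (A (VOp R k g)) = g - ((k:ℂ) ^ 2) • VOp R k g := by
      rw [hAV k hk, hlin.1 _ hP.1 _ (D.smul_mem _ hV), hlin.2 _ _ hV, hAP, hAV k hk]
      match_scalars
      · ring
      · ring
      · linear_combination (k:ℂ) ^ 2 * Complex.I_sq
    rw [hU k hk, hAA]
    simp only [smul_apply, add_apply,
      sub_apply, ContinuousLinearMap.id_apply, hopp k hk]
    match_scalars
    · ring
    · field_simp
      linear_combination -Complex.I_sq
  refine ⟨C ^ 2 + 1, by positivity, fun k hk => ?_⟩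
  have hk0 : (0:ℝ) < k := by exact_mod_cast hk
  have hp : ‖R k - R ((k + 1 : ℕ) : ℤ)‖ ≤ C ^ 2 / (k:ℝ) ^ 2 :=
    norm_resolvent_sub_le hres hbound hk (by simp) (by push_cast; exact abs_of_nonneg (by omega))
      (by simp)
  have hm : ‖R (-(k:ℤ)) - R (-((k + 1 : ℕ) : ℤ))‖ ≤ C ^ 2 / (k:ℝ) ^ 2 :=
    norm_resolvent_sub_le hres hbound hk (by simp)
      (by rw [abs_neg]; push_cast; exact abs_of_nonneg (by omega)) (by simp)
  rw [hS' k hk, hS' (k + 1) (by omega), hU' k hk, hU' (k + 1) (by omega)]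
  generalize R k = P at *
  generalize R (-(k:ℤ)) = Q at *
  generalize R ((k + 1 : ℕ) : ℤ) = P' at *
  generalize R (-((k + 1 : ℕ) : ℤ)) = Q' at *
  constructor
  · have e : (2⁻¹ : ℂ) • (P + Q) - (2⁻¹ : ℂ) • (P' + Q')
        = (2⁻¹ : ℂ) • ((P - P') + (Q - Q')) := by module
    rw [e, norm_smul, norm_inv, Complex.norm_ofNat, add_div]
    have h := norm_add_le (P - P') (Q - Q')
    have h1 : 0 ≤ 1 / (k:ℝ) ^ 2 := by positivity
    linarith
  · have e : ((k:ℂ))⁻¹ • ContinuousLinearMap.id ℂ X + (Complex.I / 2) • (P - Q)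
        - (((k + 1 : ℕ) : ℂ)⁻¹ • ContinuousLinearMap.id ℂ X + (Complex.I / 2) • (P' - Q'))
        = ((k:ℂ)⁻¹ - ((k + 1 : ℕ) : ℂ)⁻¹) • ContinuousLinearMap.id ℂ X
          + (Complex.I / 2) • ((P - P') - (Q - Q')) := by module
    have hscal : ‖(k:ℂ)⁻¹ - ((k + 1 : ℕ) : ℂ)⁻¹‖ ≤ 1 / (k:ℝ) ^ 2 := by
      have hcast : (k:ℂ)⁻¹ - ((k + 1 : ℕ) : ℂ)⁻¹ = ((1 / (k * (k + 1)) : ℝ) : ℂ) := by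
        have h0 : (k:ℂ) ≠ 0 := by exact_mod_cast hk0.ne'
        have h1 : (k:ℂ) + 1 ≠ 0 := by exact_mod_cast k.succ_ne_zero
        push_cast
        field_simp
        ring
      rw [hcast, Complex.norm_real, Real.norm_of_nonneg (by positivity)]
      gcongr
      nlinarith
    have hid : ‖((k:ℂ)⁻¹ - ((k + 1 : ℕ) : ℂ)⁻¹) • ContinuousLinearMap.id ℂ X‖
        ≤ 1 / (k:ℝ) ^ 2 := by
      rw [norm_smul]
      exact (mul_le_of_le_one_right (norm_nonneg _) ContinuousLinearMap.norm_id_le).trans hscal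
    have hI : ‖Complex.I / 2‖ = 1 / 2 := by simp
    have hR : ‖(Complex.I / 2) • ((P - P') - (Q - Q'))‖ ≤ C ^ 2 / (k:ℝ) ^ 2 := by
      rw [norm_smul, hI]
      linarith [norm_sub_le (P - P') (Q - Q')]
    rw [e, add_div]
    linarith [norm_add_le (((k:ℂ)⁻¹ - ((k + 1 : ℕ) : ℂ)⁻¹) • ContinuousLinearMap.id ℂ X)
      ((Complex.I / 2) • ((P - P') - (Q - Q')))]
end
end

section
/- Let A be an N×N complex matrix that is unitarily diagonalizable, A = Q^H D Q with Q unitary and D = diag(λ_1, …, λ_N), and suppose e^{2πλ_j} ≠ 1 for every j. Then for any f ∈ ℂ^N the function v(t) = Q^H diag( e^{λ_1 t} ψ_1(2πλ_1), …, e^{λ_N t} ψ_1(2πλ_N) ) Q f, where ψ_1(z) = z/(e^z − 1) (extended by ψ_1(0) = 1), satisfies v'(t) = A v(t) for all t ∈ (0, 2π) and (1/(2π)) ∫₀^{2π} v(t) dt = f. -/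
open Real Matrix MeasureTheory

noncomputable section

/-- `ψ₁(z) = z/(e^z - 1)`, extended by `ψ₁(0) = 1`. -/
def psi1 (z : ℂ) : ℂ := if z = 0 then 1 else z / (Complex.exp z - 1)

/-- The scalar mode `e^{at} ψ₁(2πa)` has mean value one over `[0, 2π]`. -/
lemma integral_exp_mul_psi1 {a : ℂ} (ha : Complex.exp (2*(π:ℂ)*a) ≠ 1) :
    ∫ t in (0:ℝ)..(2*π), Complex.exp (a * (t:ℂ)) * psi1 (2*(π:ℂ)*a) = 2*(π:ℂ) := by
  have ha0 : a ≠ 0 := by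
    rintro rfl
    simp at ha
  have hpi : (π:ℂ) ≠ 0 := Complex.ofReal_ne_zero.mpr Real.pi_ne_zero
  have hne : Complex.exp (2*(π:ℂ)*a) - 1 ≠ 0 := sub_ne_zero.mpr ha
  have hz : 2*(π:ℂ)*a ≠ 0 := mul_ne_zero (mul_ne_zero two_ne_zero hpi) ha0
  rw [intervalIntegral.integral_mul_const, integral_exp_mul_complex ha0, psi1, if_neg hz]
  push_cast
  rw [mul_comm a (2*(π:ℂ)), mul_zero, Complex.exp_zero]
  field_simp

lemma hasDerivAt_exp_mul_ofReal (a c : ℂ) (t : ℝ) :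
    HasDerivAt (fun s : ℝ => Complex.exp (a * (s:ℂ)) * c)
      (a * (Complex.exp (a * (t:ℂ)) * c)) t := by
  have h := ((Complex.ofRealCLM.hasDerivAt (x := t)).const_mul a).cexp.mul_const c
  have he : a * (Complex.exp (a * (t:ℂ)) * c) = Complex.exp (a * (t:ℂ)) * (a * 1) * c := by ring
  rw [he]
  simpa using h

theorem matrix_solution_formula
    (N : ℕ) (Q : Matrix (Fin N) (Fin N) ℂ) (lam : Fin N → ℂ)
    (hQ1 : Qᴴ * Q = 1) (hQ2 : Q * Qᴴ = 1)
    (A : Matrix (Fin N) (Fin N) ℂ)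
    (hA : A = Qᴴ * Matrix.diagonal lam * Q)
    (hlam : ∀ j, Complex.exp (2*(π:ℂ)*lam j) ≠ 1)
    (f : Fin N → ℂ)
    (v : ℝ → Fin N → ℂ)
    (hv : v = fun (t : ℝ) =>
      (Qᴴ * Matrix.diagonal (fun j => Complex.exp (lam j * (t:ℂ)) * psi1 (2*(π:ℂ)*lam j)) * Q).mulVec f) :
    (∀ t ∈ Set.Ioo (0:ℝ) (2*π), HasDerivAt v (A.mulVec (v t)) t) ∧
    (1/(2*π) : ℝ) • (∫ t in (0:ℝ)..(2*π), v t) = f := by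
  subst hA hv
  set g : Fin N → ℂ := Q *ᵥ f with hg
  set w : ℝ → Fin N → ℂ := fun t j =>
    Complex.exp (lam j * (t:ℂ)) * psi1 (2*(π:ℂ)*lam j) * g j with hw
  let L : (Fin N → ℂ) →L[ℝ] (Fin N → ℂ) :=
    ((Matrix.mulVecLin Qᴴ).restrictScalars ℝ).toContinuousLinearMap
  have hL : ∀ x, L x = Qᴴ *ᵥ x := fun _ => rfl
  have hv : (fun t : ℝ => (Qᴴ * Matrix.diagonal (fun j =>
      Complex.exp (lam j * (t:ℂ)) * psi1 (2*(π:ℂ)*lam j)) * Q).mulVec f) = fun t => L (w t) := by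
    funext t
    rw [hL, ← Matrix.mulVec_mulVec, ← Matrix.mulVec_mulVec]
    congr 1
    funext j
    rw [Matrix.mulVec_diagonal]
  have hwd : ∀ t, HasDerivAt w (fun j => lam j * w t j) t := fun t =>
    hasDerivAt_pi.mpr fun j => by
      simpa only [hw, mul_assoc] using
        hasDerivAt_exp_mul_ofReal (lam j) (psi1 (2*(π:ℂ)*lam j) * g j) t
  have hwc : Continuous w := continuous_iff_continuousAt.mpr fun t => (hwd t).continuousAt
  have hint : ∫ t in (0:ℝ)..(2*π), w t = (2*π : ℝ) • g := by
    funext j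
    have h := (ContinuousLinearMap.proj (R := ℝ) (φ := fun _ : Fin N => ℂ) j).intervalIntegral_comp_comm
      (hwc.intervalIntegrable (μ := volume) 0 (2*π))
    simp only [ContinuousLinearMap.proj_apply] at h
    rw [← h, intervalIntegral.integral_mul_const, integral_exp_mul_psi1 (hlam j)]
    simp
  rw [hv]
  refine ⟨fun t _ => ?_, ?_⟩
  · have hA : (Qᴴ * Matrix.diagonal lam * Q).mulVec (L (w t)) = L (fun j => lam j * w t j) := by
      rw [hL, hL, Matrix.mulVec_mulVec, Matrix.mul_assoc _ Q, hQ2, Matrix.mul_one,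
        ← Matrix.mulVec_mulVec]
      congr 1
      funext j
      rw [Matrix.mulVec_diagonal]
    rw [hA]
    exact L.hasFDerivAt.comp_hasDerivAt t (hwd t)
  · rw [L.intervalIntegral_comp_comm (hwc.intervalIntegrable _ _), hint, map_smul, smul_smul,
      one_div, inv_mul_cancel₀ (by positivity), one_smul, hL, hg, Matrix.mulVec_mulVec, hQ1,
      Matrix.one_mulVec]
end
end
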